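/- The Möbius function satisfies (1/N²) ∑_{n=1}^{N} ∑_{m=1}^{N} μ(n) μ(m) μ(n+m) → 0 as N → ∞. -/

import Mathlib

open Finset Filter Topology ArithmeticFunction

/-- The summatory function of `a`, normalised and in the logarithmic variable `u = -log x`:
`x⁻¹ ∑_{k ≤ x} a k`. -/
noncomputable def logMean (a : ℕ → ℂ) (u : ℝ) : ℂ :=
  Real.exp u • ∑ k ∈ Icc 1 ⌊Real.exp (-u)⌋₊, a k

section Tauberian

open MeasureTheory FourierTransform Complex

variable {a : ℕ → ℂ}

lemma norm_sum_Icc_le_of_norm_le_one (ha : ∀ n, ‖a n‖ ≤ 1) (m n : ℕ) :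
    ‖∑ k ∈ Icc (m + 1) n, a k‖ ≤ (n - m : ℕ) := by
  refine (norm_sum_le_of_le _ fun k _ ↦ ha k).trans ?_
  simp

lemma norm_logMean_le_one (ha : ∀ n, ‖a n‖ ≤ 1) (u : ℝ) : ‖logMean a u‖ ≤ 1 := by
  have h1 := norm_sum_Icc_le_of_norm_le_one ha 0 ⌊Real.exp (-u)⌋₊
  have h2 : (⌊Real.exp (-u)⌋₊ : ℝ) ≤ Real.exp (-u) := Nat.floor_le (Real.exp_pos _).le
  rw [logMean, norm_smul, Real.norm_eq_abs, abs_of_pos (Real.exp_pos _)]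
  calc _ ≤ Real.exp u * Real.exp (-u) := by
        gcongr
        exact h1.trans (by simpa using h2)
    _ = 1 := by rw [← Real.exp_add]; simp

lemma logMean_of_pos (a : ℕ → ℂ) {u : ℝ} (hu : 0 < u) : logMean a u = 0 := by
  have : ⌊Real.exp (-u)⌋₊ = 0 := by
    rw [Nat.floor_eq_zero]; simpa using hu
  simp [logMean, this]

lemma measurable_logMean (a : ℕ → ℂ) : Measurable (logMean a) := by
  have h : Measurable fun n : ℕ ↦ ∑ k ∈ Icc 1 n, a k := measurable_from_nat
  have h2 : Measurable fun u : ℝ ↦ ⌊Real.exp (-u)⌋₊ :=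
    Nat.measurable_floor.comp (by fun_prop)
  exact (Real.measurable_exp).smul (h.comp h2)

lemma norm_logMean_sub_le_of_le (ha : ∀ n, ‖a n‖ ≤ 1) {u v : ℝ} (huv : u ≤ v) :
    ‖logMean a u - logMean a v‖ ≤ 2 * (v - u) + Real.exp u := by
  set m := ⌊Real.exp (-v)⌋₊ with hm
  set n := ⌊Real.exp (-u)⌋₊ with hn
  have hmn : m ≤ n := Nat.floor_le_floor (by gcongr)
  have hm1 : (m : ℝ) ≤ Real.exp (-v) := Nat.floor_le (Real.exp_pos _).le
  have hm2 : Real.exp (-v) < m + 1 := Nat.lt_floor_add_one _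
  have hn1 : (n : ℝ) ≤ Real.exp (-u) := Nat.floor_le (Real.exp_pos _).le
  have hsplit : ∑ k ∈ Icc 1 n, a k = ∑ k ∈ Icc 1 m, a k + ∑ k ∈ Icc (m + 1) n, a k := by
    have h (m n : ℕ) : Icc (m + 1) n = Ioc m n := by ext; simp
    rw [h m n, ← zero_add 1, h 0 n, h 0 m, Finset.sum_Ioc_consecutive _ (Nat.zero_le _) hmn]
  have key : logMean a u - logMean a v = Real.exp u • ∑ k ∈ Icc (m + 1) n, a k
      + (Real.exp u - Real.exp v) • ∑ k ∈ Icc 1 m, a k := by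
    rw [logMean, logMean, ← hm, ← hn, hsplit, smul_add, sub_smul]; ring
  have b1 := norm_sum_Icc_le_of_norm_le_one ha m n
  have b2 := norm_sum_Icc_le_of_norm_le_one ha 0 m
  rw [Nat.cast_sub hmn] at b1
  have b1' : ‖∑ k ∈ Icc (m + 1) n, a k‖ ≤ Real.exp (-u) - Real.exp (-v) + 1 := by linarith
  have b2' : ‖∑ k ∈ Icc 1 m, a k‖ ≤ Real.exp (-v) := by
    simp only [zero_add, tsub_zero] at b2; linarith
  have e1 : Real.exp u * Real.exp (-u) = 1 := by rw [← Real.exp_add]; simp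
  have e2 : Real.exp v * Real.exp (-v) = 1 := by rw [← Real.exp_add]; simp
  have e3 : Real.exp u * Real.exp (-v) = Real.exp (u - v) := by
    rw [← Real.exp_add]; ring_nf
  have e4 := Real.add_one_le_exp (u - v)
  have huv' : Real.exp u ≤ Real.exp v := by gcongr
  calc _ ≤ Real.exp u * (Real.exp (-u) - Real.exp (-v) + 1)
        + (Real.exp v - Real.exp u) * Real.exp (-v) := by
        rw [key]
        refine (norm_add_le _ _).trans (add_le_add ?_ ?_)
        · rw [norm_smul, Real.norm_eq_abs, abs_of_pos (Real.exp_pos _)]; gcongr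
        · rw [norm_smul, Real.norm_eq_abs, abs_sub_comm, abs_of_nonneg (by linarith)]
          have : 0 ≤ Real.exp v - Real.exp u := by linarith
          gcongr
    _ ≤ _ := by linarith

/-- `logMean a` is slowly oscillating at `-∞`. -/
lemma norm_logMean_sub_le (ha : ∀ n, ‖a n‖ ≤ 1) (u v : ℝ) :
    ‖logMean a u - logMean a v‖ ≤ 2 * |v - u| + Real.exp u := by
  rcases le_total u v with h | h
  · rw [abs_of_nonneg (by linarith)]; exact norm_logMean_sub_le_of_le ha h
  · rw [norm_sub_rev, abs_of_nonpos (by linarith)]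
    have := norm_logMean_sub_le_of_le ha h
    have : Real.exp v ≤ Real.exp u := by gcongr
    linarith

lemma integrable_exp_smul_logMean (ha : ∀ n, ‖a n‖ ≤ 1) {δ : ℝ} (hδ : 0 < δ) :
    Integrable fun u ↦ Real.exp (δ * u) • logMean a u := by
  have h1 : Integrable ((Set.Iic (0 : ℝ)).indicator fun u ↦ Real.exp (δ * u)) := by
    rw [integrable_indicator_iff measurableSet_Iic]
    exact integrableOn_exp_mul_Iic hδ 0
  refine h1.mono' ?_ (ae_of_all _ fun u ↦ ?_)
  · exact (Measurable.smul (f := fun u ↦ Real.exp (δ * u)) (by fun_prop)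
      (measurable_logMean a)).aestronglyMeasurable
  · rcases le_or_gt u 0 with h | h
    · rw [Set.indicator_of_mem (by simpa using h), norm_smul, Real.norm_eq_abs,
        abs_of_pos (Real.exp_pos _)]
      exact mul_le_of_le_one_right (Real.exp_pos _).le (norm_logMean_le_one ha u)
    · simp [logMean_of_pos a h, h]

lemma fourier_exp_smul_logMean (ha : ∀ n, ‖a n‖ ≤ 1) {δ : ℝ} (hδ : 0 < δ) (ξ : ℝ) :
    𝓕 (fun u : ℝ ↦ Real.exp (δ * u) • logMean a u) ξ
      = LSeries a (1 + δ - 2 * Real.pi * ξ * I) / (1 + δ - 2 * Real.pi * ξ * I) := by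
  set s : ℂ := 1 + δ - 2 * Real.pi * ξ * I with hs
  have hre : s.re = 1 + δ := by simp [hs]
  have him : s.im = -(2 * Real.pi * ξ) := by simp [hs]
  have hs0 : s ≠ 0 := fun h ↦ by rw [h] at hre; simp at hre; linarith
  have hO : (fun n ↦ ∑ k ∈ Icc 1 n, ‖a k‖) =O[atTop] fun n ↦ (n : ℝ) ^ (1 : ℝ) := by
    refine Asymptotics.isBigO_of_le _ fun n ↦ ?_
    rw [Real.norm_eq_abs, abs_of_nonneg (Finset.sum_nonneg fun _ _ ↦ norm_nonneg _), Real.rpow_one,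
      Real.norm_eq_abs, abs_of_nonneg (by positivity)]
    exact (Finset.sum_le_sum fun k _ ↦ ha k).trans (by simp)
  have h1 := LSeries_eq_mul_integral' a zero_le_one (s := s) (by rw [hre]; linarith) hO
  have h2 := mellin_eq_fourier (fun t : ℝ ↦ ∑ k ∈ Icc 1 ⌊t⌋₊, a k) (s := -s)
  have hmellin : mellin (fun t : ℝ ↦ ∑ k ∈ Icc 1 ⌊t⌋₊, a k) (-s)
      = ∫ t in Set.Ioi (1 : ℝ), (∑ k ∈ Icc 1 ⌊t⌋₊, a k) * t ^ (-(s + 1)) := by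
    rw [mellin, ← setIntegral_eq_of_subset_of_ae_sdiff_eq_zero (s := Set.Ioi (1 : ℝ))
      measurableSet_Ioi.nullMeasurableSet (Set.Ioi_subset_Ioi zero_le_one)]
    · refine setIntegral_congr_fun measurableSet_Ioi fun t _ ↦ ?_
      simp only [smul_eq_mul]
      rw [mul_comm]; ring_nf
    · have : ∀ᵐ t : ℝ, t ≠ 1 := by simp [ae_iff, measure_singleton]
      filter_upwards [this] with t ht htm
      have : ⌊t⌋₊ = 0 := by
        rw [Nat.floor_eq_zero]
        have := htm.2
        simp only [Set.mem_Ioi, not_lt] at this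
        exact lt_of_le_of_ne this ht
      simp [this]
  rw [h1, mul_div_cancel_left₀ _ hs0, ← hmellin, h2]
  have hξ : (-s).im / (2 * Real.pi) = ξ := by
    rw [neg_im, him]; field_simp
  rw [hξ]
  refine congrArg (fun f : ℝ → ℂ ↦ 𝓕 f ξ) (funext fun u ↦ ?_)
  rw [logMean, neg_re, hre, neg_neg, smul_smul, ← Real.exp_add]
  congr 2; ring

lemma integral_fourier_mul_eq_of_integrable {f g : ℝ → ℂ} (hf : Integrable f)
    (hg : Integrable g) : ∫ ξ, 𝓕 f ξ * g ξ = ∫ u, f u * 𝓕 g u := by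
  have h := VectorFourier.integral_fourierIntegral_smul_eq_flip (L := innerₗ ℝ)
    Real.continuous_fourierChar continuous_inner hf hg
  rw [flip_innerₗ] at h
  exact h

lemma tendsto_integral_exp_smul_logMean_mul (ha : ∀ n, ‖a n‖ ≤ 1) {k : ℝ → ℂ}
    (hk : Integrable k) :
    Tendsto (fun δ : ℝ ↦ ∫ u, (Real.exp (δ * u) • logMean a u) * k u) (𝓝[>] 0)
      (𝓝 (∫ u, logMean a u * k u)) := by
  have hδ : ∀ᶠ δ : ℝ in 𝓝[>] 0, 0 < δ := eventually_mem_nhdsWithin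
  refine tendsto_integral_filter_of_dominated_convergence (fun u ↦ ‖k u‖) ?_ ?_ hk.norm ?_
  · exact hδ.mono fun δ h ↦
      (integrable_exp_smul_logMean ha h).aestronglyMeasurable.mul hk.aestronglyMeasurable
  · refine hδ.mono fun δ h ↦ ae_of_all _ fun u ↦ ?_
    rw [norm_mul]
    refine mul_le_of_le_one_left (norm_nonneg _) ?_
    rcases le_or_gt u 0 with hu | hu
    · rw [norm_smul, Real.norm_eq_abs, abs_of_pos (Real.exp_pos _)]
      refine mul_le_one₀ ?_ (norm_nonneg _) (norm_logMean_le_one ha u)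
      rw [Real.exp_le_one_iff]
      exact mul_nonpos_of_nonneg_of_nonpos h.le hu
    · simp [logMean_of_pos a hu]
  · refine ae_of_all _ fun u ↦ ?_
    have h : Continuous fun δ : ℝ ↦ (Real.exp (δ * u) • logMean a u) * k u := by fun_prop
    have := (h.tendsto 0).mono_left (nhdsWithin_le_nhds (s := Set.Ioi 0))
    simpa using this

/-- Pairing the normalised summatory function with the Fourier transform of a compactly supported
function only involves the boundary values of the Dirichlet series on `re s = 1`. -/
lemma integral_logMean_mul_fourier (ha : ∀ n, ‖a n‖ ≤ 1) {G : ℂ → ℂ}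
    (hG : ContinuousOn G {s | 1 ≤ s.re}) (hL : ∀ s : ℂ, 1 < s.re → LSeries a s = G s)
    {φ : ℝ → ℂ} (hφ : Continuous φ) (hφc : HasCompactSupport φ) (hφi : Integrable (𝓕 φ)) :
    ∫ u, logMean a u * 𝓕 φ u
      = ∫ ξ : ℝ, G (1 - 2 * Real.pi * ξ * I) / (1 - 2 * Real.pi * ξ * I) * φ ξ := by
  set F : ℝ → ℝ → ℂ := fun δ ξ ↦
    G (1 + δ - 2 * Real.pi * ξ * I) / (1 + δ - 2 * Real.pi * ξ * I) * φ ξ with hF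
  have hcont : ContinuousOn (Function.uncurry F) (Set.Ici 0 ×ˢ Set.univ) := by
    have hmap : Continuous fun p : ℝ × ℝ ↦ (1 + p.1 - 2 * Real.pi * p.2 * I : ℂ) := by fun_prop
    have hre (p : ℝ × ℝ) : (1 + p.1 - 2 * Real.pi * p.2 * I : ℂ).re = 1 + p.1 := by simp
    refine ((hG.comp hmap.continuousOn fun p hp ↦ ?_).div hmap.continuousOn fun p hp h ↦ ?_).mul
      (hφ.comp continuous_snd).continuousOn
    · have : 0 ≤ p.1 := hp.1
      simp only [Set.mem_ofPred_eq, hre]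
      linarith
    · have : 0 ≤ p.1 := hp.1
      have h' := hre p
      rw [h] at h'
      simp at h'
      linarith
  have h1 : ContinuousOn (fun δ ↦ ∫ ξ, F δ ξ) (Set.Ici 0) := by
    refine continuousOn_integral_of_compact_support hφc hcont fun p x _ hx ↦ ?_
    simp [hF, image_eq_zero_of_notMem_tsupport hx]
  have h2 : Tendsto (fun δ ↦ ∫ ξ, F δ ξ) (𝓝[>] 0) (𝓝 (∫ ξ, F 0 ξ)) :=
    (h1 0 Set.self_mem_Ici).mono_left (nhdsWithin_mono _ Set.Ioi_subset_Ici_self)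
  have h3 := tendsto_integral_exp_smul_logMean_mul ha hφi
  have h4 : (fun δ : ℝ ↦ ∫ u, (Real.exp (δ * u) • logMean a u) * 𝓕 φ u)
      =ᶠ[𝓝[>] 0] fun δ ↦ ∫ ξ, F δ ξ := by
    filter_upwards [self_mem_nhdsWithin] with δ hδ
    have hδ' : 0 < δ := hδ
    rw [← integral_fourier_mul_eq_of_integrable (integrable_exp_smul_logMean ha hδ')
      (hφ.integrable_of_hasCompactSupport hφc)]
    refine integral_congr_ae (ae_of_all _ fun ξ ↦ ?_)
    simp only [hF]
    rw [fourier_exp_smul_logMean ha hδ', hL _ (by simpa using hδ')]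
  have h5 := tendsto_nhds_unique (h3.congr' h4) h2
  rw [h5]
  simp [hF]

lemma tendsto_integral_logMean_mul_fourier_sub (ha : ∀ n, ‖a n‖ ≤ 1) {G : ℂ → ℂ}
    (hG : ContinuousOn G {s | 1 ≤ s.re}) (hL : ∀ s : ℂ, 1 < s.re → LSeries a s = G s)
    {φ : ℝ → ℂ} (hφ : Continuous φ) (hφc : HasCompactSupport φ) (hφi : Integrable (𝓕 φ)) :
    Tendsto (fun T ↦ ∫ u, logMean a u * 𝓕 φ (u - T)) atBot (𝓝 0) := by
  have hshift (T u : ℝ) : 𝓕 φ (u - T) = 𝓕 (fun ξ : ℝ ↦ Real.fourierChar (T * ξ) • φ ξ) u := by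
    rw [Real.fourier_eq, Real.fourier_eq]
    refine integral_congr_ae (ae_of_all _ fun ξ ↦ ?_)
    simp only [smul_smul, ← AddChar.map_add_eq_mul]
    congr 2
    simp
    ring
  have hmain (T : ℝ) : ∫ u, logMean a u * 𝓕 φ (u - T) = 𝓕 (fun ξ : ℝ ↦
      G (1 - 2 * Real.pi * ξ * I) / (1 - 2 * Real.pi * ξ * I) * φ ξ) (-T) := by
    simp_rw [hshift T]
    rw [integral_logMean_mul_fourier ha hG hL]
    · rw [Real.fourier_eq]
      refine integral_congr_ae (ae_of_all _ fun ξ ↦ ?_)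
      simp [Circle.smul_def]
      ring
    · simp only [Circle.smul_def]
      have := Real.continuous_fourierChar
      fun_prop
    · exact hφc.mono fun ξ h ↦ by
        contrapose! h
        simp only [Function.mem_support, not_not] at h ⊢
        simp [h]
    · have : 𝓕 (fun ξ : ℝ ↦ Real.fourierChar (T * ξ) • φ ξ) = fun u ↦ 𝓕 φ (u - T) := by
        ext u; rw [hshift]
      rw [this]
      exact hφi.comp_sub_right T
  simp_rw [hmain]
  refine (Real.zero_at_infty_fourier _).comp ?_
  exact tendsto_neg_atBot_atTop.mono_right atTop_le_cocompact

/-- Approximate identities with compactly supported Fourier transform. -/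
lemma exists_approximate_identity_fourier {ε : ℝ} (hε : 0 < ε) :
    ∃ φ : ℝ → ℂ, Continuous φ ∧ HasCompactSupport φ ∧ Integrable (𝓕 φ) ∧ ∫ u, 𝓕 φ u = 1 ∧
      Integrable (fun u ↦ |u| * ‖𝓕 φ u‖) ∧ ∫ u, |u| * ‖𝓕 φ u‖ ≤ ε := by
  let b : ContDiffBump (0 : ℝ) := default
  have hbs : ContDiff ℝ (⊤ : ℕ∞) fun x ↦ (b x : ℂ) := ofRealCLM.contDiff.comp b.contDiff
  have hbc : HasCompactSupport fun x ↦ (b x : ℂ) :=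
    b.hasCompactSupport.comp_left (g := fun x : ℝ ↦ (x : ℂ)) (by simp)
  set ψ : SchwartzMap ℝ ℂ := hbc.toSchwartzMap hbs with hψ
  have hψ0 : ψ 0 = 1 := by
    have : b 0 = 1 := b.one_of_mem_closedBall (by simp [b.rIn_pos.le])
    simp [hψ, this]
  set K : SchwartzMap ℝ ℂ := 𝓕 ψ with hK
  have hKψ : (K : ℝ → ℂ) = 𝓕 (ψ : ℝ → ℂ) := SchwartzMap.fourier_coe ψ
  have hK1 : ∫ u, K u = 1 := by
    have h := congrFun (ψ.continuous.fourierInv_fourier_eq ψ.integrable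
      (hKψ ▸ K.integrable)) 0
    rw [Real.fourierInv_eq, hψ0] at h
    simpa [hKψ] using h
  have hKi : Integrable fun u : ℝ ↦ |u| * ‖K u‖ := by
    simpa using K.integrable_pow_mul volume 1
  set B := ∫ u : ℝ, |u| * ‖K u‖ with hB
  have hB0 : 0 ≤ B := integral_nonneg fun u ↦ by positivity
  set l : ℝ := B / ε + 1 with hl
  have hl0 : 0 < l := by positivity
  have hF (u : ℝ) : 𝓕 (fun ξ : ℝ ↦ ψ (l⁻¹ * ξ)) u = l * K (l * u) := by
    rw [hKψ, Real.fourier_eq, Real.fourier_eq]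
    have := Measure.integral_comp_mul_left
      (fun v : ℝ ↦ Real.fourierChar (-(inner ℝ v (l * u))) • ψ v) l⁻¹
    rw [inv_inv, abs_of_pos hl0] at this
    rw [← real_smul, ← this]
    refine integral_congr_ae (ae_of_all _ fun ξ ↦ ?_)
    simp only [RCLike.inner_apply, conj_trivial]
    congr 3
    field_simp
  have hF' : 𝓕 (fun ξ : ℝ ↦ ψ (l⁻¹ * ξ)) = fun u : ℝ ↦ l * K (l * u) := funext hF
  have hscale (u : ℝ) : |u| * ‖(l * K (l * u) : ℂ)‖ = |l * u| * ‖K (l * u)‖ := by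
    rw [norm_mul, abs_mul, norm_real, Real.norm_eq_abs]; ring
  refine ⟨fun ξ ↦ ψ (l⁻¹ * ξ), ψ.continuous.comp (by fun_prop), ?_, ?_, ?_, ?_, ?_⟩
  · exact hbc.comp_homeomorph (Homeomorph.mulLeft₀ l⁻¹ (by positivity))
  · rw [hF']
    exact ((integrable_comp_mul_left_iff _ hl0.ne').2 K.integrable).const_mul _
  · rw [hF', integral_const_mul, Measure.integral_comp_mul_left (fun u ↦ K u), hK1,
      abs_of_pos (by positivity)]
    simp [hl0.ne']
  · simp_rw [hF', hscale]
    exact (integrable_comp_mul_left_iff (fun u : ℝ ↦ |u| * ‖K u‖) hl0.ne').2 hKi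
  · simp_rw [hF', hscale]
    rw [Measure.integral_comp_mul_left (fun u : ℝ ↦ |u| * ‖K u‖), ← hB,
      abs_of_pos (by positivity), smul_eq_mul, inv_mul_le_iff₀ hl0, hl, add_mul,
      div_mul_cancel₀ _ hε.ne']
    linarith

/-- Tauberian theorem for bounded coefficients: if the Dirichlet series extends continuously to
`1 ≤ re s`, then the coefficients have mean value zero. -/
theorem tendsto_logMean_of_continuousOn_LSeries (ha : ∀ n, ‖a n‖ ≤ 1) {G : ℂ → ℂ}
    (hG : ContinuousOn G {s | 1 ≤ s.re}) (hL : ∀ s : ℂ, 1 < s.re → LSeries a s = G s) :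
    Tendsto (logMean a) atBot (𝓝 0) := by
  rw [Metric.tendsto_nhds]
  intro ε hε
  obtain ⟨φ, hφ, hφc, hφi, hφ1, hφw, hφb⟩ :=
    exists_approximate_identity_fourier (ε := ε / 8) (by positivity)
  have h1 := tendsto_integral_logMean_mul_fourier_sub ha hG hL hφ hφc hφi
  set B := ∫ u, ‖𝓕 φ u‖ with hB
  have h2 : Tendsto (fun T ↦ Real.exp T * B) atBot (𝓝 0) := by
    simpa using Real.tendsto_exp_atBot.mul_const B
  have h1' := (Metric.tendsto_nhds.1 h1) (ε / 4) (by positivity)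
  have h2' := (Metric.tendsto_nhds.1 h2) (ε / 4) (by positivity)
  filter_upwards [h1', h2'] with T hT1 hT2
  rw [dist_zero_right] at hT1 hT2 ⊢
  have hT2' := (le_abs_self _).trans_lt hT2
  have hφiT : Integrable fun u ↦ 𝓕 φ (u - T) := hφi.comp_sub_right T
  have hφwT : Integrable fun u ↦ |u - T| * ‖𝓕 φ (u - T)‖ := hφw.comp_sub_right T
  have hgi : Integrable fun u ↦ logMean a u * 𝓕 φ (u - T) :=
    hφiT.bdd_mul (measurable_logMean a).aestronglyMeasurable
      (ae_of_all _ (norm_logMean_le_one ha))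
  have e1 : logMean a T - ∫ u, logMean a u * 𝓕 φ (u - T)
      = ∫ u, (logMean a T - logMean a u) * 𝓕 φ (u - T) := by
    simp_rw [sub_mul]
    rw [integral_sub (hφiT.const_mul _) hgi, integral_const_mul,
      integral_sub_right_eq_self (fun u ↦ 𝓕 φ u), hφ1, mul_one]
  have e2 : ‖∫ u, (logMean a T - logMean a u) * 𝓕 φ (u - T)‖
      ≤ ∫ u, (2 * (|u - T| * ‖𝓕 φ (u - T)‖) + Real.exp T * ‖𝓕 φ (u - T)‖) := by
    refine norm_integral_le_of_norm_le ((hφwT.const_mul _).add (hφiT.norm.const_mul _))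
      (ae_of_all _ fun u ↦ ?_)
    rw [norm_mul, ← mul_assoc, ← add_mul]
    exact mul_le_mul_of_nonneg_right (norm_logMean_sub_le ha T u) (norm_nonneg _)
  have e3 : ∫ u, (2 * (|u - T| * ‖𝓕 φ (u - T)‖) + Real.exp T * ‖𝓕 φ (u - T)‖)
      = 2 * (∫ u, |u| * ‖𝓕 φ u‖) + Real.exp T * B := by
    rw [integral_add (hφwT.const_mul _) (hφiT.norm.const_mul _), integral_const_mul,
      integral_const_mul, integral_sub_right_eq_self (fun u ↦ |u| * ‖𝓕 φ u‖),
      integral_sub_right_eq_self (fun u ↦ ‖𝓕 φ u‖)]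
  have e4 : ‖logMean a T‖ ≤ ‖logMean a T - ∫ u, logMean a u * 𝓕 φ (u - T)‖
      + ‖∫ u, logMean a u * 𝓕 φ (u - T)‖ := by
    simpa using norm_add_le (logMean a T - ∫ u, logMean a u * 𝓕 φ (u - T))
      (∫ u, logMean a u * 𝓕 φ (u - T))
  rw [e1] at e4
  rw [e3] at e2
  linarith

theorem tendsto_mean_of_continuousOn_LSeries (ha : ∀ n, ‖a n‖ ≤ 1) {G : ℂ → ℂ}
    (hG : ContinuousOn G {s | 1 ≤ s.re}) (hL : ∀ s : ℂ, 1 < s.re → LSeries a s = G s) :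
    Tendsto (fun N : ℕ ↦ (∑ n ∈ Icc 1 N, a n) / N) atTop (𝓝 0) := by
  have h := (tendsto_logMean_of_continuousOn_LSeries ha hG hL).comp
    (tendsto_neg_atTop_atBot.comp (Real.tendsto_log_atTop.comp tendsto_natCast_atTop_atTop))
  refine h.congr' ?_
  filter_upwards [eventually_gt_atTop 0] with N hN
  have hN' : (0 : ℝ) < N := by exact_mod_cast hN
  simp only [Function.comp_apply, logMean, neg_neg, Real.exp_log hN', Real.exp_neg,
    Nat.floor_natCast, real_smul, ofReal_inv, ofReal_natCast]
  rw [div_eq_inv_mul]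

end Tauberian

section Periodic

open Complex

/-- `f` has no correlation with the Möbius function: `∑_{n ≤ N} μ(n) f(n) = o(N)`. -/
def MoebiusOrthogonal (f : ℕ → ℂ) : Prop :=
  Tendsto (fun N : ℕ ↦ (∑ n ∈ Icc 1 N, (moebius n : ℂ) * f n) / N) atTop (𝓝 0)

lemma norm_moebius_le_one (n : ℕ) : ‖(moebius n : ℂ)‖ ≤ 1 := by
  rw [norm_intCast]
  exact_mod_cast abs_moebius_le_one

lemma MoebiusOrthogonal.const_mul {f : ℕ → ℂ} (hf : MoebiusOrthogonal f) (c : ℂ) :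
    MoebiusOrthogonal fun n ↦ c * f n := by
  have h := Tendsto.const_mul c hf
  rw [mul_zero] at h
  refine h.congr fun N ↦ ?_
  rw [← mul_div_assoc, mul_sum]
  simp_rw [mul_left_comm]

lemma MoebiusOrthogonal.sum {ι : Type*} {s : Finset ι} {f : ι → ℕ → ℂ}
    (hf : ∀ i ∈ s, MoebiusOrthogonal (f i)) : MoebiusOrthogonal fun n ↦ ∑ i ∈ s, f i n := by
  have h := tendsto_finsetSum s hf
  rw [sum_const_zero] at h
  refine h.congr fun N ↦ ?_
  rw [← sum_div, sum_comm]
  simp_rw [mul_sum]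

lemma DirichletCharacter.moebiusOrthogonal {q : ℕ} [NeZero q] (χ : DirichletCharacter ℂ q) :
    MoebiusOrthogonal fun n ↦ χ n := by
  have hle (n : ℕ) : ‖χ n * (moebius n : ℂ)‖ ≤ 1 := by
    rw [norm_mul]
    exact mul_le_one₀ (χ.norm_le_one _) (norm_nonneg _) (norm_moebius_le_one n)
  have hinv {s : ℂ} (hs : 1 < s.re) :
      LSeries (fun n ↦ χ n * (moebius n : ℂ)) s = (χ.LFunction s)⁻¹ := by
    rw [χ.LFunction_eq_LSeries hs]
    exact eq_inv_of_mul_eq_one_right (LSeries.mul_mu_eq_one χ hs)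
  suffices h : ∃ G : ℂ → ℂ, ContinuousOn G {s | 1 ≤ s.re} ∧
      ∀ s : ℂ, 1 < s.re → LSeries (fun n ↦ χ n * (moebius n : ℂ)) s = G s by
    obtain ⟨G, hG, hL⟩ := h
    refine (tendsto_mean_of_continuousOn_LSeries hle hG hL).congr fun N ↦ ?_
    simp_rw [mul_comm]
  by_cases hχ : χ = 1
  · subst hχ
    refine ⟨fun s ↦ (s - 1) / LFunctionTrivChar₁ q s, ?_, fun s hs ↦ ?_⟩
    · refine ContinuousOn.div (by fun_prop)
        (differentiable_LFunctionTrivChar₁ q).continuous.continuousOn fun s hs ↦ ?_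
      rcases eq_or_ne s 1 with rfl | h1
      · exact LFunctionTrivChar₁_apply_one_ne_zero q
      · rw [LFunctionTrivChar₁, Function.update_of_ne h1]
        exact mul_ne_zero (sub_ne_zero.2 h1) (LFunction_ne_zero_of_one_le_re _ (.inr h1) hs)
    · have h1 : s ≠ 1 := fun h ↦ by simp [h] at hs
      rw [hinv hs]
      simp only [LFunctionTrivChar₁, Function.update_of_ne h1]
      rw [div_mul_cancel_left₀ (sub_ne_zero.2 h1)]
  · refine ⟨fun s ↦ (χ.LFunction s)⁻¹, ?_, fun s hs ↦ hinv hs⟩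
    exact (differentiable_LFunction hχ).continuous.continuousOn.inv₀ fun s hs ↦
      LFunction_ne_zero_of_one_le_re _ (.inl hχ) hs

lemma moebiusOrthogonal_of_coprime {q : ℕ} [NeZero q] (ψ : ZMod q → ℂ) :
    MoebiusOrthogonal fun n ↦ if n.Coprime q then ψ n else 0 := by
  classical
  have h : MoebiusOrthogonal fun n ↦ ∑ a ∈ univ.filter (fun a : ZMod q ↦ IsUnit a),
      ∑ χ : DirichletCharacter ℂ q, ψ a * (q.totient : ℂ)⁻¹ * χ a⁻¹ * χ n :=
    .sum fun a _ ↦ .sum fun χ _ ↦ χ.moebiusOrthogonal.const_mul _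
  convert h using 2 with n
  have hφ : (q.totient : ℂ) ≠ 0 := by
    exact_mod_cast (Nat.totient_pos.2 (NeZero.pos q)).ne'
  have hsum : ∀ a ∈ univ.filter (fun a : ZMod q ↦ IsUnit a),
      ∑ χ : DirichletCharacter ℂ q, ψ a * (q.totient : ℂ)⁻¹ * χ a⁻¹ * χ n
        = if a = n then ψ a else 0 := by
    intro a ha
    simp_rw [mul_assoc]
    rw [← mul_sum, ← mul_sum, DirichletCharacter.sum_char_inv_mul_char_eq ℂ (mem_filter.1 ha).2]
    split_ifs
    · field_simp
    · simp
  rw [sum_congr rfl hsum, sum_ite_eq']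
  simp [ZMod.isUnit_iff_coprime]

lemma sum_Icc_ite_dvd {M : Type*} [AddCommMonoid M] (f : ℕ → M) {d : ℕ} (hd : 0 < d) (N : ℕ) :
    (∑ n ∈ Icc 1 N, if d ∣ n then f n else 0) = ∑ m ∈ Icc 1 (N / d), f (d * m) := by
  symm
  refine sum_of_injOn (fun m ↦ d * m) ?_ ?_ ?_ ?_
  · intro x _ y _ h
    exact Nat.eq_of_mul_eq_mul_left hd h
  · intro m hm
    simp only [coe_Icc, Set.mem_Icc] at hm ⊢
    refine ⟨Nat.mul_pos hd hm.1, ?_⟩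
    have := (Nat.le_div_iff_mul_le hd).1 hm.2
    linarith [mul_comm m d]
  · intro n hn hn'
    rw [if_neg]
    rintro ⟨m, rfl⟩
    refine hn' ⟨m, ?_, rfl⟩
    simp only [coe_Icc, Set.mem_Icc, mem_Icc] at hn ⊢
    refine ⟨Nat.pos_of_mul_pos_left hn.1, (Nat.le_div_iff_mul_le hd).2 ?_⟩
    linarith [mul_comm m d]
  · intro m _
    simp

lemma MoebiusOrthogonal.of_dilate {f : ℕ → ℂ} {d : ℕ} (hd : 0 < d)
    (hf : ∀ n, ¬ d ∣ n → f n = 0)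
    (hg : MoebiusOrthogonal fun m ↦ if d.Coprime m then f (d * m) else 0) :
    MoebiusOrthogonal f := by
  set g : ℕ → ℂ := fun m ↦ if d.Coprime m then f (d * m) else 0 with hgdef
  have hsum (N : ℕ) : ∑ n ∈ Icc 1 N, (moebius n : ℂ) * f n
      = moebius d * ∑ m ∈ Icc 1 (N / d), (moebius m : ℂ) * g m := by
    have h0 (n : ℕ) : (moebius n : ℂ) * f n = if d ∣ n then (moebius n : ℂ) * f n else 0 := by
      split_ifs with h
      · rfl
      · rw [hf n h, mul_zero]
    rw [sum_congr rfl fun n _ ↦ h0 n, sum_Icc_ite_dvd _ hd, mul_sum]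
    refine sum_congr rfl fun m _ ↦ ?_
    simp only [hgdef]
    split_ifs with h
    · rw [isMultiplicative_moebius.map_mul_of_coprime h]
      push_cast; ring
    · have : moebius (d * m) = 0 :=
        moebius_eq_zero_of_not_squarefree fun hs ↦ h (Nat.coprime_of_squarefree_mul hs)
      simp [this]
  have h1 : Tendsto (fun N : ℕ ↦ N / d) atTop atTop := Nat.tendsto_div_const_atTop hd.ne'
  have h2 := Tendsto.const_mul (moebius d : ℂ) (Tendsto.comp hg h1)
  rw [mul_zero] at h2
  refine squeeze_zero_norm (fun N ↦ ?_) (tendsto_zero_iff_norm_tendsto_zero.1 h2)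
  simp only [Function.comp_apply, hsum, ← mul_div_assoc]
  rw [norm_div, norm_div, Complex.norm_natCast, Complex.norm_natCast]
  rcases Nat.eq_zero_or_pos (N / d) with h0 | h0
  · simp [h0]
  · refine div_le_div_of_nonneg_left (norm_nonneg _) (by exact_mod_cast h0) ?_
    exact_mod_cast Nat.div_le_self N d

/-- The Möbius function does not correlate with periodic functions. -/
theorem moebiusOrthogonal_of_periodic {q : ℕ} [NeZero q] (ψ : ZMod q → ℂ) :
    MoebiusOrthogonal fun n ↦ ψ n := by
  have hq : 0 < q := NeZero.pos q
  have h : MoebiusOrthogonal fun n ↦ ∑ d ∈ q.divisors, if n.gcd q = d then ψ n else 0 := by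
    refine .sum fun d hd ↦ ?_
    have hdq := Nat.dvd_of_mem_divisors hd
    have hd0 : 0 < d := Nat.pos_of_mem_divisors hd
    refine .of_dilate hd0 (fun n hn ↦ ?_) ?_
    · exact if_neg fun h : n.gcd q = d ↦ hn (h ▸ Nat.gcd_dvd_left n q)
    convert moebiusOrthogonal_of_coprime (fun x : ZMod q ↦ ψ (d * x)) using 2 with m
    have hiff : (d.Coprime m ∧ (d * m).gcd q = d) ↔ m.Coprime q := by
      obtain ⟨e, rfl⟩ := hdq
      rw [Nat.gcd_mul_left, Nat.coprime_mul_iff_right, Nat.coprime_comm (m := d)]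
      simp [Nat.Coprime, hd0.ne']
    by_cases h1 : d.Coprime m <;> by_cases h2 : (d * m).gcd q = d <;>
      simp [h1, h2, ← hiff]
  convert h using 2 with n
  rw [sum_ite_eq, if_pos]
  simp [Nat.gcd_dvd_right, hq.ne']

lemma moebiusOrthogonal_pow {w : ℂ} {h : ℕ} (hh : 0 < h) (hw : w ^ h = 1) :
    MoebiusOrthogonal fun n ↦ w ^ n := by
  have : NeZero h := ⟨hh.ne'⟩
  convert moebiusOrthogonal_of_periodic (fun x : ZMod h ↦ w ^ x.val) using 2 with n
  rw [ZMod.val_natCast, ← pow_mod_orderOf w n, ← pow_mod_orderOf w (n % h),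
    Nat.mod_mod_of_dvd _ (orderOf_dvd_of_pow_eq_one hw)]

end Periodic

section MajorArcs

open Complex

/-- The exponential sum `∑_{n ≤ N} μ(n) zⁿ`. -/
noncomputable def moebiusExpSum (N : ℕ) (z : ℂ) : ℂ := ∑ n ∈ Icc 1 N, (moebius n : ℂ) * z ^ n

lemma MoebiusOrthogonal.eventually_forall_le {f : ℕ → ℂ} (hf : MoebiusOrthogonal f)
    {ε : ℝ} (hε : 0 < ε) :
    ∀ᶠ N : ℕ in atTop, ∀ k ≤ N, ‖∑ n ∈ Icc 1 k, (moebius n : ℂ) * f n‖ ≤ ε * N := by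
  obtain ⟨K, hK⟩ := eventually_atTop.1 (Metric.tendsto_nhds.1 hf ε hε)
  set F : ℕ → ℝ := fun k ↦ ‖∑ n ∈ Icc 1 k, (moebius n : ℂ) * f n‖ with hF
  have hlim : Tendsto (fun N : ℕ ↦ ε * (N : ℝ)) atTop atTop :=
    tendsto_natCast_atTop_atTop.const_mul_atTop hε
  filter_upwards [hlim.eventually_ge_atTop (∑ k ∈ range (K + 1), F k)] with N hN k hk
  rcases le_or_gt k K with hkK | hkK
  · refine le_trans ?_ hN
    exact single_le_sum (f := F) (fun i _ ↦ norm_nonneg _) (mem_range.2 (by omega))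
  · have h := hK k hkK.le
    have hk0 : (0 : ℝ) < k := by exact_mod_cast (Nat.zero_le K).trans_lt hkK
    rw [dist_zero_right, norm_div, Complex.norm_natCast, div_lt_iff₀ hk0] at h
    refine h.le.trans ?_
    gcongr

lemma norm_sum_mul_pow_le {b : ℕ → ℂ} {N : ℕ} {M : ℝ} {v : ℂ} (hv : ‖v‖ = 1)
    (hb : ∀ k ≤ N, ‖∑ n ∈ Icc 1 k, b n‖ ≤ M) :
    ‖∑ n ∈ Icc 1 N, b n * v ^ n‖ ≤ (1 + N * ‖v - 1‖) * M := by
  have habel : ∀ K : ℕ, ∑ n ∈ Icc 1 K, b n * v ^ n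
      = (∑ n ∈ Icc 1 K, b n) * v ^ K
        - ∑ k ∈ range K, (∑ n ∈ Icc 1 k, b n) * (v ^ k * (v - 1)) := by
    intro K
    induction K with
    | zero => simp
    | succ K ih =>
      rw [sum_Icc_succ_top (by omega), sum_Icc_succ_top (by omega), sum_range_succ, ih]
      ring
  have h2 : ‖∑ k ∈ range N, (∑ n ∈ Icc 1 k, b n) * (v ^ k * (v - 1))‖ ≤ N * (M * ‖v - 1‖) := by
    refine (norm_sum_le_of_le (f := fun k ↦ (∑ n ∈ Icc 1 k, b n) * (v ^ k * (v - 1)))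
      (n := fun _ ↦ M * ‖v - 1‖) _ fun k hk ↦ ?_).trans (by simp)
    rw [norm_mul, norm_mul, norm_pow, hv, one_pow, one_mul]
    exact mul_le_mul_of_nonneg_right (hb k (mem_range.1 hk).le) (norm_nonneg _)
  rw [habel]
  refine (norm_sub_le _ _).trans ?_
  rw [norm_mul, norm_pow, hv, one_pow, mul_one]
  linarith [hb N le_rfl]

/-- If `zʰ` is close to `1`, then `z` is close to an `h`-th root of unity. -/
lemma exists_pow_eq_one_and_norm_sub_one_le {z : ℂ} (hz : ‖z‖ = 1) {h : ℕ} (hh : 0 < h) :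
    ∃ w v : ℂ, w ^ h = 1 ∧ ‖v‖ = 1 ∧ z = w * v ∧ ‖v - 1‖ ≤ 2 * ‖z ^ h - 1‖ := by
  have hh' : (h : ℂ) ≠ 0 := by exact_mod_cast hh.ne'
  have hz0 : z ^ h ≠ 0 := pow_ne_zero _ fun h ↦ by simp [h] at hz
  have hzn : ‖z ^ h‖ = 1 := by rw [norm_pow, hz, one_pow]
  set v : ℂ := exp (I * ((z ^ h).arg / h : ℝ)) with hv
  have hv1 : ‖v‖ = 1 := by rw [hv, mul_comm]; exact norm_exp_ofReal_mul_I _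
  have hv0 : v ≠ 0 := exp_ne_zero _
  have hvh : v ^ h = z ^ h := by
    have h1 : z ^ h = exp ((z ^ h).arg * I) := by
      conv_lhs => rw [← norm_mul_exp_arg_mul_I (z ^ h), hzn]
      simp
    rw [h1, hv, ← exp_nat_mul]
    congr 1
    push_cast
    field_simp
  refine ⟨z / v, v, ?_, hv1, (div_mul_cancel₀ _ hv0).symm, ?_⟩
  · rw [div_pow, hvh, div_self hz0]
  · have h1 : ‖v - 1‖ ≤ |(z ^ h).arg| := by
      refine (Real.norm_exp_I_mul_ofReal_sub_one_le).trans ?_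
      rw [Real.norm_eq_abs, abs_div, Nat.abs_cast]
      exact div_le_self (abs_nonneg _) (by exact_mod_cast hh)
    have h2 := angle_le_mul_norm_sub hzn (norm_one (α := ℂ))
    rw [angle_one_right hz0] at h2
    have h3 : Real.pi / 2 * ‖z ^ h - 1‖ ≤ 2 * ‖z ^ h - 1‖ :=
      mul_le_mul_of_nonneg_right (by linarith [Real.pi_le_four]) (norm_nonneg _)
    linarith

lemma eventually_norm_moebiusExpSum_le_of_major (P : ℕ) (C : ℝ) {ε : ℝ} (hε : 0 < ε) :
    ∀ᶠ N : ℕ in atTop, ∀ z : ℂ, ‖z‖ = 1 → ∀ h ∈ Icc 1 P, N * ‖z ^ h - 1‖ ≤ C →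
      ‖moebiusExpSum N z‖ ≤ ε * N := by
  rcases lt_or_ge C 0 with hC | hC
  · refine .of_forall fun N z _ h _ hle ↦ ?_
    have : 0 ≤ N * ‖z ^ h - 1‖ := by positivity
    linarith
  have hfin (h : ℕ) (hh : h ∈ Icc 1 P) : {w : ℂ | w ^ h = 1}.Finite := by
    refine (Polynomial.nthRootsFinset h (1 : ℂ)).finite_toSet.subset fun w hw ↦ ?_
    rw [mem_coe, Polynomial.mem_nthRootsFinset (mem_Icc.1 hh).1]
    exact hw
  have hev : ∀ᶠ N : ℕ in atTop, ∀ h ∈ Icc 1 P, ∀ w ∈ {w : ℂ | w ^ h = 1}, ∀ k ≤ N,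
      ‖∑ n ∈ Icc 1 k, (moebius n : ℂ) * w ^ n‖ ≤ ε / (1 + 2 * C) * N := by
    rw [eventually_all_finset]
    intro h hh
    rw [eventually_all_finite (hfin h hh)]
    intro w hw
    exact (moebiusOrthogonal_pow (mem_Icc.1 hh).1 hw).eventually_forall_le (by positivity)
  filter_upwards [hev] with N hN z hz h hh hle
  obtain ⟨w, v, hw, hv, rfl, hvz⟩ := exists_pow_eq_one_and_norm_sub_one_le hz (mem_Icc.1 hh).1
  have h1 := norm_sum_mul_pow_le hv (hN h hh w hw)
  simp only [moebiusExpSum, mul_pow, ← mul_assoc]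
  refine h1.trans ?_
  have h2 : N * ‖v - 1‖ ≤ N * (2 * ‖(w * v) ^ h - 1‖) := by gcongr
  calc _ ≤ (1 + 2 * C) * (ε / (1 + 2 * C) * N) := by
        exact mul_le_mul_of_nonneg_right (by linarith) (by positivity)
    _ = ε * N := by field_simp

end MajorArcs

section MinorArcs

open Complex ComplexConjugate

lemma norm_sum_Icc_pow_le {y : ℂ} (hy : ‖y‖ = 1) {η : ℝ} (hη : 0 < η) (hy1 : η ≤ ‖y - 1‖) (M : ℕ) :
    ‖∑ m ∈ Icc 1 M, y ^ m‖ ≤ 2 / η := by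
  have hne : y ≠ 1 := fun h ↦ by simp [h] at hy1; linarith
  have h1 : ∑ m ∈ Icc 1 M, y ^ m = y * ((y ^ M - 1) / (y - 1)) := by
    rw [← geom_sum_eq hne]
    induction M with
    | zero => simp
    | succ M ih => rw [sum_Icc_succ_top (by omega), ih, sum_range_succ, mul_add, pow_succ']
  rw [h1, norm_mul, hy, one_mul, norm_div]
  have h2 : ‖y ^ M - 1‖ ≤ 2 := by
    refine (norm_sub_le _ _).trans ?_
    rw [norm_pow, hy]; norm_num
  gcongr

lemma card_Icc_filter_dvd (N p : ℕ) : #{n ∈ Icc 1 N | p ∣ n} = N / p := by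
  rw [← Nat.Ioc_filter_dvd_card_eq_div]
  rfl

lemma sum_Icc_ite_dvd_one (N d : ℕ) :
    (∑ n ∈ Icc 1 N, if d ∣ n then (1 : ℝ) else 0) = (N / d : ℕ) := by
  rw [← card_Icc_filter_dvd, card_filter]; push_cast; rfl

/-- The variance inequality of Turán and Kubilius for a finite set of primes. -/
lemma sum_card_sub_sq_le {S : Finset ℕ} (hS : ∀ p ∈ S, p.Prime) (N : ℕ) :
    ∑ n ∈ Icc 1 N, ((#{p ∈ S | p ∣ n} : ℝ) - ∑ p ∈ S, 1 / (p : ℝ)) ^ 2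
      ≤ N * (∑ p ∈ S, 1 / (p : ℝ)) + 2 * (∑ p ∈ S, 1 / (p : ℝ)) * #S := by
  set L := ∑ p ∈ S, 1 / (p : ℝ) with hL
  have hL0 : 0 ≤ L := sum_nonneg fun p _ ↦ by positivity
  have hω (n : ℕ) : (#{p ∈ S | p ∣ n} : ℝ) = ∑ p ∈ S, if p ∣ n then (1 : ℝ) else 0 := by
    rw [card_filter]; push_cast; rfl
  have h1 : (N : ℝ) * L - #S ≤ ∑ n ∈ Icc 1 N, (#{p ∈ S | p ∣ n} : ℝ) := by
    simp_rw [hω]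
    rw [sum_comm, hL, mul_sum, card_eq_sum_ones, Nat.cast_sum, ← sum_sub_distrib]
    refine sum_le_sum fun p hp ↦ ?_
    have hp0 : (0 : ℝ) < p := by exact_mod_cast (hS p hp).pos
    rw [sum_Icc_ite_dvd_one, Nat.cast_one, mul_one_div]
    have := Nat.lt_floor_add_one ((N : ℝ) / p)
    rw [Nat.floor_div_eq_div] at this
    linarith
  have h2 : ∑ n ∈ Icc 1 N, (#{p ∈ S | p ∣ n} : ℝ) ^ 2 ≤ N * L + N * L ^ 2 := by
    have e1 (n : ℕ) : (#{p ∈ S | p ∣ n} : ℝ) ^ 2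
        = ∑ p ∈ S, ∑ p' ∈ S, if p ∣ n ∧ p' ∣ n then (1 : ℝ) else 0 := by
      rw [hω, sq, sum_mul_sum]
      refine sum_congr rfl fun p _ ↦ sum_congr rfl fun p' _ ↦ ?_
      by_cases ha : p ∣ n <;> by_cases hb : p' ∣ n <;> simp [ha, hb]
    have e2 : ∑ n ∈ Icc 1 N, (#{p ∈ S | p ∣ n} : ℝ) ^ 2 = ∑ p ∈ S, ∑ p' ∈ S,
        ∑ n ∈ Icc 1 N, if p ∣ n ∧ p' ∣ n then (1 : ℝ) else 0 := by
      simp_rw [e1]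
      rw [sum_comm]
      exact sum_congr rfl fun p _ ↦ sum_comm
    have e3 : (N : ℝ) * L + N * L ^ 2 = ∑ p ∈ S, ∑ p' ∈ S,
        ((if p = p' then (N : ℝ) * (1 / p) else 0) + N * (1 / p * (1 / p'))) := by
      simp_rw [sum_add_distrib]
      congr 1
      · rw [hL, mul_sum]
        exact sum_congr rfl fun p hp ↦ by rw [sum_ite_eq, if_pos hp]
      · simp_rw [← mul_sum, ← sum_mul]
        rw [← hL, sq]
    rw [e2, e3]
    refine sum_le_sum fun p hp ↦ sum_le_sum fun p' hp' ↦ ?_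
    by_cases hpp : p = p'
    · subst hpp
      simp only [and_self, if_true, sum_Icc_ite_dvd_one]
      have : ((N / p : ℕ) : ℝ) ≤ N / p := Nat.cast_div_le
      rw [mul_one_div]
      have : 0 ≤ (N : ℝ) * (1 / p * (1 / p)) := by positivity
      linarith
    · have hco := (Nat.coprime_primes (hS p hp) (hS p' hp')).2 hpp
      have e4 (n : ℕ) : (p ∣ n ∧ p' ∣ n) ↔ p * p' ∣ n :=
        ⟨fun h ↦ hco.mul_dvd_of_dvd_of_dvd h.1 h.2,
          fun h ↦ ⟨dvd_of_mul_right_dvd h, dvd_of_mul_left_dvd h⟩⟩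
      simp only [e4, sum_Icc_ite_dvd_one, if_neg hpp, zero_add]
      refine Nat.cast_div_le.trans (le_of_eq ?_)
      push_cast
      field_simp
  have h3 : ∑ n ∈ Icc 1 N, ((#{p ∈ S | p ∣ n} : ℝ) - L) ^ 2
      = ∑ n ∈ Icc 1 N, (#{p ∈ S | p ∣ n} : ℝ) ^ 2
        - 2 * L * ∑ n ∈ Icc 1 N, (#{p ∈ S | p ∣ n} : ℝ) + N * L ^ 2 := by
    simp_rw [sub_sq, sum_add_distrib, sum_sub_distrib]
    simp only [sum_const, Nat.card_Icc, add_tsub_cancel_right, nsmul_eq_mul, mul_sum]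
    congr 2
    exact sum_congr rfl fun n _ ↦ by ring
  rw [h3]
  nlinarith [mul_le_mul_of_nonneg_left h1 hL0]

lemma norm_sum_moebius_mul_sq_le (N : ℕ) (g : ℕ → ℂ) :
    ‖∑ n ∈ Icc 1 N, (moebius n : ℂ) * g n‖ ^ 2 ≤ N * ∑ n ∈ Icc 1 N, ‖g n‖ ^ 2 := by
  have h1 : ‖∑ n ∈ Icc 1 N, (moebius n : ℂ) * g n‖ ≤ ∑ n ∈ Icc 1 N, ‖g n‖ := by
    refine norm_sum_le_of_le _ fun n _ ↦ ?_
    rw [norm_mul]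
    exact mul_le_of_le_one_left (norm_nonneg _) (norm_moebius_le_one n)
  refine (pow_le_pow_left₀ (norm_nonneg _) h1 2).trans ?_
  simpa using sq_sum_le_card_mul_sum_sq (s := Icc 1 N) (f := fun n ↦ ‖g n‖)

/-- The bilinear estimate of Daboussi and Kátai. -/
lemma sum_norm_sq_sum_pow_le {S : Finset ℕ} (hS : ∀ p ∈ S, 0 < p) (N : ℕ) {z : ℂ} (hz : ‖z‖ = 1)
    {η : ℝ} (hη : 0 < η) (hsep : ∀ p ∈ S, ∀ p' ∈ S, p ≠ p' → η ≤ ‖z ^ p - z ^ p'‖) :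
    ∑ m ∈ Icc 1 N, ‖∑ p ∈ S, if p * m ≤ N then z ^ (p * m) else 0‖ ^ 2
      ≤ N * (∑ p ∈ S, 1 / (p : ℝ)) + #S ^ 2 * (2 / η) := by
  set x : ℕ → ℕ → ℂ := fun p m ↦ if p * m ≤ N then z ^ (p * m) else 0 with hx
  have hexp : ((∑ m ∈ Icc 1 N, ‖∑ p ∈ S, x p m‖ ^ 2 : ℝ) : ℂ)
      = ∑ p ∈ S, ∑ p' ∈ S, ∑ m ∈ Icc 1 N, x p m * conj (x p' m) := by
    push_cast
    simp_rw [← mul_conj', map_sum, sum_mul_sum]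
    rw [sum_comm]
    exact sum_congr rfl fun p _ ↦ sum_comm
  have hterm : ∀ p ∈ S, ∀ p' ∈ S, ‖∑ m ∈ Icc 1 N, x p m * conj (x p' m)‖
      ≤ (if p = p' then (N : ℝ) * (1 / p) else 0) + 2 / η := by
    intro p hp p' hp'
    set M := min (N / p) (N / p') with hM
    have hMN : M ≤ N := (min_le_left _ _).trans (Nat.div_le_self _ _)
    set y := z ^ p * conj (z ^ p') with hy
    have hyn : ‖y‖ = 1 := by simp [hy, hz]
    have e1 (m : ℕ) : x p m * conj (x p' m) = if m ≤ M then y ^ m else 0 := by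
      have i1 : p * m ≤ N ↔ m ≤ N / p := by rw [Nat.le_div_iff_mul_le (hS p hp), mul_comm]
      have i2 : p' * m ≤ N ↔ m ≤ N / p' := by rw [Nat.le_div_iff_mul_le (hS p' hp'), mul_comm]
      simp only [hx, i1, i2, hM, le_min_iff]
      by_cases ha : m ≤ N / p <;> by_cases hb : m ≤ N / p' <;> simp [ha, hb, hy, pow_mul, mul_pow]
    have e2 : ∑ m ∈ Icc 1 N, x p m * conj (x p' m) = ∑ m ∈ Icc 1 M, y ^ m := by
      simp_rw [e1]
      rw [← sum_filter]
      congr 1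
      ext m
      simp only [mem_filter, mem_Icc]
      omega
    rw [e2]
    by_cases hpp : p = p'
    · subst hpp
      rw [if_pos rfl, mul_one_div]
      have h1 : ‖∑ m ∈ Icc 1 M, y ^ m‖ ≤ M := by
        refine (norm_sum_le_of_le (n := fun _ ↦ 1) _ fun m _ ↦ ?_).trans (by simp)
        rw [norm_pow, hyn, one_pow]
      have h2 : (M : ℝ) ≤ N / p := by
        rw [hM, min_self]; exact Nat.cast_div_le
      have : 0 < 2 / η := by positivity
      linarith
    · rw [if_neg hpp, zero_add]
      refine norm_sum_Icc_pow_le hyn hη ?_ M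
      have : z ^ p - z ^ p' = (y - 1) * z ^ p' := by
        have hzz : conj (z ^ p') * z ^ p' = 1 := by
          rw [conj_mul', norm_pow, hz]; simp
        rw [hy, sub_mul, mul_assoc, hzz]; ring
      have h2 := hsep p hp p' hp' hpp
      rwa [this, norm_mul, norm_pow, hz, one_pow, mul_one] at h2
  have h0 : 0 ≤ ∑ m ∈ Icc 1 N, ‖∑ p ∈ S, x p m‖ ^ 2 := sum_nonneg fun _ _ ↦ by positivity
  calc ∑ m ∈ Icc 1 N, ‖∑ p ∈ S, x p m‖ ^ 2
      = ‖((∑ m ∈ Icc 1 N, ‖∑ p ∈ S, x p m‖ ^ 2 : ℝ) : ℂ)‖ := by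
        rw [norm_real, Real.norm_eq_abs, abs_of_nonneg h0]
    _ ≤ ∑ p ∈ S, ∑ p' ∈ S, ((if p = p' then (N : ℝ) * (1 / p) else 0) + 2 / η) := by
        rw [hexp]
        exact norm_sum_le_of_le _ fun p hp ↦ norm_sum_le_of_le _ fun p' hp' ↦ hterm p hp p' hp'
    _ = N * (∑ p ∈ S, 1 / (p : ℝ)) + #S ^ 2 * (2 / η) := by
        simp_rw [sum_add_distrib]
        congr 1
        · rw [mul_sum]
          exact sum_congr rfl fun p hp ↦ by rw [sum_ite_eq, if_pos hp]
        · simp only [sum_const, nsmul_eq_mul]; ring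

lemma sum_one_div_sq_le {S : Finset ℕ} (hS : ∀ p ∈ S, 0 < p) :
    ∑ p ∈ S, 1 / (p : ℝ) ^ 2 ≤ 2 := by
  have h := sum_Ioo_inv_sq_le (α := ℝ) 0 (S.sup id + 1)
  refine le_trans ?_ (h.trans (by norm_num))
  simp_rw [one_div]
  refine sum_le_sum_of_subset_of_nonneg (fun p hp ↦ ?_) fun _ _ _ ↦ by positivity
  exact mem_Ioo.2 ⟨hS p hp, Nat.lt_succ_of_le (le_sup (f := id) hp)⟩

lemma norm_sum_moebius_mul_card_add_le {S : Finset ℕ} (hS : ∀ p ∈ S, p.Prime) (N : ℕ) {z : ℂ}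
    (hz : ‖z‖ = 1) :
    ‖∑ n ∈ Icc 1 N, (moebius n : ℂ) * (z ^ n * #{p ∈ S | p ∣ n})
      + ∑ m ∈ Icc 1 N, (moebius m : ℂ) * ∑ p ∈ S, if p * m ≤ N then z ^ (p * m) else 0‖
      ≤ 2 * N := by
  have e1 : ∑ n ∈ Icc 1 N, (moebius n : ℂ) * (z ^ n * #{p ∈ S | p ∣ n})
      = ∑ p ∈ S, ∑ m ∈ Icc 1 (N / p), (moebius (p * m) : ℂ) * z ^ (p * m) := by
    have hω (n : ℕ) : (moebius n : ℂ) * (z ^ n * #{p ∈ S | p ∣ n})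
        = ∑ p ∈ S, if p ∣ n then (moebius n : ℂ) * z ^ n else 0 := by
      rw [← sum_filter, sum_const, nsmul_eq_mul]; ring
    simp_rw [hω]
    rw [sum_comm]
    exact sum_congr rfl fun p hp ↦
      sum_Icc_ite_dvd (fun n ↦ (moebius n : ℂ) * z ^ n) (hS p hp).pos N
  have e2 : ∑ m ∈ Icc 1 N, (moebius m : ℂ) * (∑ p ∈ S, if p * m ≤ N then z ^ (p * m) else 0)
      = ∑ p ∈ S, ∑ m ∈ Icc 1 (N / p), (moebius m : ℂ) * z ^ (p * m) := by
    simp_rw [mul_sum]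
    rw [sum_comm]
    refine sum_congr rfl fun p hp ↦ ?_
    simp_rw [mul_ite, mul_zero]
    rw [← sum_filter]
    congr 1
    ext m
    have i1 : p * m ≤ N ↔ m ≤ N / p := by
      rw [Nat.le_div_iff_mul_le (hS p hp).pos, mul_comm]
    have i2 := Nat.div_le_self N p
    simp only [mem_filter, mem_Icc, i1]
    omega
  have e3 : ∀ p ∈ S, ‖∑ m ∈ Icc 1 (N / p), ((moebius (p * m) : ℂ) * z ^ (p * m)
      + (moebius m : ℂ) * z ^ (p * m))‖ ≤ N * (1 / (p : ℝ) ^ 2) := by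
    intro p hp
    have hpp := hS p hp
    have hterm (m : ℕ) : ‖(moebius (p * m) : ℂ) * z ^ (p * m) + (moebius m : ℂ) * z ^ (p * m)‖
        ≤ if p ∣ m then 1 else 0 := by
      rw [← add_mul, norm_mul, norm_pow, hz, one_pow, mul_one]
      split_ifs with h
      · have : moebius (p * m) = 0 := by
          refine moebius_eq_zero_of_not_squarefree fun hs ↦ ?_
          exact (hpp.coprime_iff_not_dvd.1 (Nat.coprime_of_squarefree_mul hs)) h
        rw [this]
        simpa using norm_moebius_le_one m
      · rw [isMultiplicative_moebius.map_mul_of_coprime (hpp.coprime_iff_not_dvd.2 h),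
          moebius_apply_prime hpp]
        simp
    refine (norm_sum_le_of_le _ fun m _ ↦ hterm m).trans ?_
    rw [sum_Icc_ite_dvd_one, Nat.div_div_eq_div_mul]
    refine Nat.cast_div_le.trans (le_of_eq ?_)
    push_cast
    ring
  rw [e1, e2, ← sum_add_distrib]
  simp_rw [← sum_add_distrib]
  refine (norm_sum_le_of_le _ e3).trans ?_
  rw [← mul_sum, mul_comm]
  exact mul_le_mul_of_nonneg_right (sum_one_div_sq_le fun p hp ↦ (hS p hp).pos) (Nat.cast_nonneg N)

lemma norm_moebiusExpSum_le_of_minor {S : Finset ℕ} (hS : ∀ p ∈ S, p.Prime) {N : ℕ} (hN : 0 < N)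
    {z : ℂ} (hz : ‖z‖ = 1) {r : ℝ} (hr : 1 ≤ r) (hL : ∑ p ∈ S, 1 / (p : ℝ) = r ^ 2)
    (hSN : 2 * #S ≤ N)
    (hsep : ∀ p ∈ S, ∀ p' ∈ S, p ≠ p' → 2 * (#S : ℝ) ^ 2 < N * ‖z ^ p - z ^ p'‖) :
    r * ‖moebiusExpSum N z‖ ≤ 6 * N := by
  have hN0 : (0 : ℝ) < N := by exact_mod_cast hN
  have hS0 : (0 : ℝ) < #S := by
    rw [Nat.cast_pos, card_pos, nonempty_iff_ne_empty]
    rintro rfl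
    simp at hL
    nlinarith
  have hSN' : 2 * (#S : ℝ) ≤ N := by exact_mod_cast hSN
  set A := ∑ n ∈ Icc 1 N, (moebius n : ℂ) * (z ^ n * #{p ∈ S | p ∣ n}) with hA
  set T := ∑ m ∈ Icc 1 N, (moebius m : ℂ) * ∑ p ∈ S, if p * m ≤ N then z ^ (p * m) else 0 with hT
  have h1 : ‖A + T‖ ≤ 2 * N := norm_sum_moebius_mul_card_add_le hS N hz
  have h2 : ‖T‖ ≤ 2 * r * N := by
    have hη : (0 : ℝ) < 2 * #S ^ 2 / N := by positivity
    have b1 := norm_sum_moebius_mul_sq_le N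
      fun m ↦ ∑ p ∈ S, if p * m ≤ N then z ^ (p * m) else 0
    have b2 := sum_norm_sq_sum_pow_le (fun p hp ↦ (hS p hp).pos) N hz hη fun p hp p' hp' hne ↦ by
      rw [div_le_iff₀' hN0]; exact (hsep p hp p' hp' hne).le
    rw [hL] at b2
    have b3 : (#S : ℝ) ^ 2 * (2 / (2 * #S ^ 2 / N)) = N := by field_simp
    rw [b3] at b2
    refine le_of_sq_le_sq ?_ (by positivity)
    calc ‖T‖ ^ 2 ≤ N * (N * r ^ 2 + N) := b1.trans (by gcongr)
      _ ≤ (2 * r * N) ^ 2 := by nlinarith [sq_nonneg (N : ℝ), mul_self_nonneg ((r - 1) * N)]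
  have h3 : ‖A - (r ^ 2 : ℝ) * moebiusExpSum N z‖ ≤ 2 * r * N := by
    have e1 : A - (r ^ 2 : ℝ) * moebiusExpSum N z
        = ∑ n ∈ Icc 1 N, (moebius n : ℂ) * (z ^ n * (#{p ∈ S | p ∣ n} - (r ^ 2 : ℝ))) := by
      rw [hA, moebiusExpSum, mul_sum, ← sum_sub_distrib]
      exact sum_congr rfl fun n _ ↦ by ring
    have b1 := norm_sum_moebius_mul_sq_le N
      fun n ↦ z ^ n * ((#{p ∈ S | p ∣ n} : ℂ) - (r ^ 2 : ℝ))
    have b2 := sum_card_sub_sq_le hS N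
    rw [hL] at b2
    have e2 (n : ℕ) : ‖z ^ n * ((#{p ∈ S | p ∣ n} : ℂ) - (r ^ 2 : ℝ))‖ ^ 2
        = ((#{p ∈ S | p ∣ n} : ℝ) - r ^ 2) ^ 2 := by
      rw [norm_mul, norm_pow, hz, one_pow, one_mul, ← ofReal_natCast, ← ofReal_sub, norm_real,
        Real.norm_eq_abs, sq_abs]
    simp_rw [e2] at b1
    rw [← e1] at b1
    refine le_of_sq_le_sq ?_ (by positivity)
    calc _ ≤ N * (N * r ^ 2 + 2 * r ^ 2 * #S) := b1.trans (by gcongr)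
      _ ≤ N * (N * r ^ 2 + r ^ 2 * N) := by
        gcongr N * (N * r ^ 2 + ?_)
        nlinarith [sq_nonneg r]
      _ ≤ (2 * r * N) ^ 2 := by nlinarith [mul_self_nonneg (r * N)]
  have h4 : r ^ 2 * ‖moebiusExpSum N z‖ ≤ 6 * r * N := by
    have e : ((r ^ 2 : ℝ) : ℂ) * moebiusExpSum N z
        = (A + T) - T - (A - (r ^ 2 : ℝ) * moebiusExpSum N z) := by ring
    have e' : r ^ 2 * ‖moebiusExpSum N z‖ = ‖((r ^ 2 : ℝ) : ℂ) * moebiusExpSum N z‖ := by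
      rw [norm_mul, norm_real, Real.norm_eq_abs, abs_of_nonneg (sq_nonneg r)]
    rw [e', e]
    refine (norm_sub_le _ _).trans ?_
    have := norm_sub_le (A + T) T
    nlinarith
  have hr0 : 0 < r := by linarith
  refine le_of_mul_le_mul_left ?_ hr0
  nlinarith

lemma exists_primes_sum_one_div_ge (B : ℝ) :
    ∃ S : Finset ℕ, (∀ p ∈ S, p.Prime) ∧ B ≤ ∑ p ∈ S, 1 / (p : ℝ) := by
  have h := (not_summable_iff_tendsto_nat_atTop_of_nonneg fun n ↦ ?_).1
    not_summable_one_div_on_primes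
  · obtain ⟨n, hn⟩ := (h.eventually_ge_atTop B).exists
    refine ⟨(range n).filter Nat.Prime, fun p hp ↦ (mem_filter.1 hp).2, hn.trans (le_of_eq ?_)⟩
    rw [sum_filter]
    exact sum_congr rfl fun p _ ↦ by simp [Set.indicator_apply]
  · exact Set.indicator_nonneg (fun _ _ ↦ by positivity) n

/-- Davenport's estimate: the exponential sums of the Möbius function are uniformly `o(N)`. -/
theorem eventually_norm_moebiusExpSum_le {ε : ℝ} (hε : 0 < ε) :
    ∀ᶠ N : ℕ in atTop, ∀ z : ℂ, ‖z‖ = 1 → ‖moebiusExpSum N z‖ ≤ ε * N := by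
  obtain ⟨S, hS, hSL⟩ := exists_primes_sum_one_div_ge ((1 + 6 / ε) ^ 2)
  set r := √(∑ p ∈ S, 1 / (p : ℝ)) with hr
  have hrr : 1 + 6 / ε ≤ r := Real.le_sqrt_of_sq_le hSL
  have hr1 : 1 ≤ r := by
    have : 0 < 6 / ε := by positivity
    linarith
  have hL : ∑ p ∈ S, 1 / (p : ℝ) = r ^ 2 := (Real.sq_sqrt (sum_nonneg fun _ _ ↦ by positivity)).symm
  filter_upwards [eventually_norm_moebiusExpSum_le_of_major (S.sup id) (2 * (#S : ℝ) ^ 2) hε,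
    eventually_ge_atTop (2 * #S), eventually_gt_atTop 0] with N hmaj hSN hN z hz
  by_cases hsep : ∀ p ∈ S, ∀ p' ∈ S, p ≠ p' → 2 * (#S : ℝ) ^ 2 < N * ‖z ^ p - z ^ p'‖
  · have h := norm_moebiusExpSum_le_of_minor hS hN hz hr1 hL hSN hsep
    have h6 : 6 ≤ r * ε := by
      rw [← div_le_iff₀ hε]; linarith
    have hr0 : 0 < r := by linarith
    refine le_of_mul_le_mul_left (h.trans ?_) hr0
    rw [← mul_assoc]
    gcongr
  · push Not at hsep
    obtain ⟨p, hp, p', hp', hne, hle⟩ := hsep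
    wlog hlt : p' < p generalizing p p'
    · exact this p' hp' p hp hne.symm (by rwa [norm_sub_rev]) (by omega)
    refine hmaj z hz (p - p') (mem_Icc.2 ⟨by omega, ?_⟩) ?_
    · exact (Nat.sub_le _ _).trans (le_sup (f := id) hp)
    · have : z ^ p - z ^ p' = (z ^ (p - p') - 1) * z ^ p' := by
        rw [sub_mul, ← pow_add, Nat.sub_add_cancel hlt.le, one_mul]
      rwa [this, norm_mul, norm_pow, hz, one_pow, mul_one] at hle

end MinorArcs

section RootsOfUnity

open Complex ComplexConjugate

variable {M : ℕ} {ζ : ℂ}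

lemma sum_primitiveRoot_pow_mul_conj (hζ : IsPrimitiveRoot ζ M) {a b : ℕ} (ha : a < M)
    (hb : b < M) :
    ∑ j ∈ range M, (ζ ^ j) ^ a * conj ((ζ ^ j) ^ b) = if a = b then (M : ℂ) else 0 := by
  have hn : ‖ζ‖ = 1 := hζ.norm'_eq_one (by omega)
  have hζζ (k : ℕ) : ζ ^ k * conj (ζ ^ k) = 1 := by
    rw [mul_conj', norm_pow, hn]; simp
  set y := ζ ^ a * conj (ζ ^ b) with hy
  have h1 (j : ℕ) : (ζ ^ j) ^ a * conj ((ζ ^ j) ^ b) = y ^ j := by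
    rw [hy, mul_pow, ← map_pow, ← pow_mul, ← pow_mul, ← pow_mul, ← pow_mul, mul_comm j a,
      mul_comm j b]
  simp_rw [h1]
  split_ifs with hab
  · have : y = 1 := by rw [hy, hab, hζζ]
    simp [this]
  · have hy1 : y ≠ 1 := by
      intro h
      refine hab (hζ.pow_inj ha hb ?_)
      calc ζ ^ a = ζ ^ a * (ζ ^ b * conj (ζ ^ b)) := by rw [hζζ, mul_one]
        _ = y * ζ ^ b := by rw [hy]; ring
        _ = ζ ^ b := by rw [h, one_mul]
    have hyM : y ^ M = 1 := by
      rw [← h1, hζ.pow_eq_one]; simp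
    rw [geom_sum_eq hy1, hyM, sub_self, zero_div]

/-- Parseval's identity on the `M`-th roots of unity for polynomials of degree less than `M`. -/
lemma sum_primitiveRoot_mul_conj (hζ : IsPrimitiveRoot ζ M) {ι κ : Type*} (s : Finset ι)
    (t : Finset κ) (a : ι → ℂ) (b : κ → ℂ) (e : ι → ℕ) (f : κ → ℕ) (he : ∀ i ∈ s, e i < M)
    (hf : ∀ k ∈ t, f k < M) :
    ∑ j ∈ range M, (∑ i ∈ s, a i * (ζ ^ j) ^ e i) * conj (∑ k ∈ t, b k * (ζ ^ j) ^ f k)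
      = M * ∑ i ∈ s, ∑ k ∈ t, if e i = f k then a i * conj (b k) else 0 := by
  simp_rw [map_sum, sum_mul_sum, mul_sum]
  rw [sum_comm]
  refine sum_congr rfl fun i hi ↦ ?_
  rw [sum_comm]
  refine sum_congr rfl fun k hk ↦ ?_
  have h := sum_primitiveRoot_pow_mul_conj hζ (he i hi) (hf k hk)
  calc ∑ j ∈ range M, a i * (ζ ^ j) ^ e i * conj (b k * (ζ ^ j) ^ f k)
      = a i * conj (b k) * ∑ j ∈ range M, (ζ ^ j) ^ e i * conj ((ζ ^ j) ^ f k) := by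
        rw [mul_sum]
        exact sum_congr rfl fun j _ ↦ by rw [map_mul]; ring
    _ = _ := by
        rw [h]
        split_ifs <;> ring

lemma sum_norm_moebiusExpSum_sq_le (hζ : IsPrimitiveRoot ζ M) {N : ℕ} (hN : N < M) :
    ∑ j ∈ range M, ‖moebiusExpSum N (ζ ^ j)‖ ^ 2 ≤ M * N := by
  have h := sum_primitiveRoot_mul_conj hζ (Icc 1 N) (Icc 1 N) (fun n ↦ (moebius n : ℂ))
    (fun n ↦ (moebius n : ℂ)) id id (fun n hn ↦ (mem_Icc.1 hn).2.trans_lt hN)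
    fun n hn ↦ (mem_Icc.1 hn).2.trans_lt hN
  have h0 : 0 ≤ ∑ j ∈ range M, ‖moebiusExpSum N (ζ ^ j)‖ ^ 2 := sum_nonneg fun _ _ ↦ by positivity
  have h1 : ((∑ j ∈ range M, ‖moebiusExpSum N (ζ ^ j)‖ ^ 2 : ℝ) : ℂ)
      = M * ∑ n ∈ Icc 1 N, (moebius n : ℂ) * conj (moebius n : ℂ) := by
    push_cast
    simp_rw [← mul_conj']
    refine h.trans ?_
    congr 1
    exact sum_congr rfl fun n hn ↦ by simp only [id, sum_ite_eq, if_pos hn]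
  rw [← abs_of_nonneg h0, ← Real.norm_eq_abs, ← norm_real, h1, norm_mul, norm_natCast]
  gcongr
  refine (norm_sum_le_of_le (n := fun _ ↦ 1) _ fun n _ ↦ ?_).trans (by simp)
  rw [norm_mul, norm_conj]
  exact mul_le_one₀ (norm_moebius_le_one n) (norm_nonneg _) (norm_moebius_le_one n)

lemma sum_moebiusExpSum_sq_mul_conj (hζ : IsPrimitiveRoot ζ M) {N : ℕ} (hN : 2 * N < M) :
    ∑ j ∈ range M, moebiusExpSum N (ζ ^ j) ^ 2 * conj (moebiusExpSum (2 * N) (ζ ^ j))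
      = M * ∑ n ∈ Icc 1 N, ∑ m ∈ Icc 1 N, (moebius n : ℂ) * moebius m * moebius (n + m) := by
  have h := sum_primitiveRoot_mul_conj hζ (Icc 1 N ×ˢ Icc 1 N) (Icc 1 (2 * N))
    (fun x ↦ (moebius x.1 : ℂ) * moebius x.2) (fun n ↦ (moebius n : ℂ)) (fun x ↦ x.1 + x.2) id
    (fun x hx ↦ by simp only [mem_product, mem_Icc] at hx; omega)
    fun n hn ↦ (mem_Icc.1 hn).2.trans_lt hN
  refine (sum_congr rfl fun j _ ↦ ?_).trans (h.trans ?_)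
  · congr 1
    rw [moebiusExpSum, sq, sum_mul_sum, sum_product]
    exact sum_congr rfl fun n _ ↦ sum_congr rfl fun m _ ↦ by ring
  · rw [sum_product]
    congr 1
    refine sum_congr rfl fun n hn ↦ sum_congr rfl fun m hm ↦ ?_
    rw [mem_Icc] at hn hm
    simp only [id, sum_ite_eq]
    rw [if_pos (mem_Icc.2 (by omega))]
    simp

lemma norm_cubic_selfcorrelation_moebius_le {N : ℕ} {B : ℝ}
    (hB : ∀ z : ℂ, ‖z‖ = 1 → ‖moebiusExpSum (2 * N) z‖ ≤ B) :
    ‖∑ n ∈ Icc 1 N, ∑ m ∈ Icc 1 N, (moebius n : ℂ) * moebius m * moebius (n + m)‖ ≤ B * N := by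
  obtain ⟨M, hM⟩ : ∃ M, 2 * N < M := ⟨_, Nat.lt_succ_self _⟩
  have hM0 : (0 : ℝ) < M := by exact_mod_cast (Nat.zero_le _).trans_lt hM
  have hζ := isPrimitiveRoot_exp M (by omega)
  set ζ := exp (2 * Real.pi * I / M)
  have hn : ‖ζ‖ = 1 := hζ.norm'_eq_one (by omega)
  have hB0 : 0 ≤ B := (norm_nonneg _).trans (hB 1 norm_one)
  refine le_of_mul_le_mul_left ?_ hM0
  calc M * ‖∑ n ∈ Icc 1 N, ∑ m ∈ Icc 1 N, (moebius n : ℂ) * moebius m * moebius (n + m)‖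
      = ‖∑ j ∈ range M, moebiusExpSum N (ζ ^ j) ^ 2 * conj (moebiusExpSum (2 * N) (ζ ^ j))‖ := by
        rw [sum_moebiusExpSum_sq_mul_conj hζ hM, norm_mul, norm_natCast]
    _ ≤ ∑ j ∈ range M, ‖moebiusExpSum N (ζ ^ j)‖ ^ 2 * B := by
        refine norm_sum_le_of_le _ fun j _ ↦ ?_
        rw [norm_mul, norm_pow, norm_conj]
        gcongr
        exact hB _ (by rw [norm_pow, hn, one_pow])
    _ ≤ M * (B * N) := by
        rw [← sum_mul, mul_comm B, ← mul_assoc]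
        gcongr
        exact sum_norm_moebiusExpSum_sq_le hζ (by omega)

end RootsOfUnity

/-- `(1/N²) ∑_{n=1}^{N} ∑_{m=1}^{N} μ(n) μ(m) μ(n+m) → 0` as `N → ∞`. -/
theorem cubic_selfcorrelation_moebius_tendsto_zero :
    Tendsto (fun N : ℕ =>
        (1 / (N : ℝ) ^ 2) * ∑ n ∈ Finset.Icc 1 N, ∑ m ∈ Finset.Icc 1 N,
          ((ArithmeticFunction.moebius n * ArithmeticFunction.moebius m *
            ArithmeticFunction.moebius (n + m) : ℤ) : ℝ))
      atTop (𝓝 0) := by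
  rw [Metric.tendsto_atTop']
  intro ε hε
  have h2 : Tendsto (fun N : ℕ ↦ 2 * N) atTop atTop :=
    tendsto_id.const_mul_atTop' (by norm_num)
  obtain ⟨N₀, hN₀⟩ := eventually_atTop.1
    (h2.eventually (eventually_norm_moebiusExpSum_le (show 0 < ε / 4 by positivity)))
  refine ⟨N₀, fun N hN ↦ ?_⟩
  have hN0 : (0 : ℝ) < N := by exact_mod_cast (Nat.zero_le _).trans_lt hN
  have h := norm_cubic_selfcorrelation_moebius_le (hN₀ N hN.le)
  have hcast : ∑ n ∈ Icc 1 N, ∑ m ∈ Icc 1 N, (moebius n : ℂ) * moebius m * moebius (n + m)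
      = ((∑ n ∈ Icc 1 N, ∑ m ∈ Icc 1 N, ((moebius n * moebius m * moebius (n + m) : ℤ) : ℝ) : ℝ)
        : ℂ) := by
    push_cast; rfl
  rw [hcast, Complex.norm_real] at h
  rw [dist_zero_right, norm_mul, Real.norm_of_nonneg (by positivity), one_div_mul_eq_div,
    div_lt_iff₀ (by positivity)]
  refine h.trans_lt ?_
  push_cast
  nlinarith [mul_pos hε (mul_pos hN0 hN0)]
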